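/- Let (Z₁,…,Z_k) be an increasing Markov chain with values in [0,1] (so Z₁≤…≤Z_k a.s., with initial distribution μ and transition kernels (Q_{i-1,i})_{i=2,…,k}); set Z₀:=0, Z_{k+1}:=1 and Y_j:=Z_j−Z_{j-1} for j=1,…,k+1. Let X be a random variable with values in {1,…,k+1} such that 𝒫[X=j | Z₁,…,Z_k] = Y_j a.s. for every j. Then for every j∈{1,…,k+1} with 𝒫(X=j)>0, there exist a probability measure μ^{(j)} on [0,1] and Markov kernels Q^{(j)}_{i-1,i} on [0,1] (i=2,…,k) such that for all Borel Γ₁,…,Γ_k⊆[0,1]: 𝒫[Z₁∈Γ₁,…,Z_k∈Γ_k | X=j] = ∫_{Γ₁}…∫_{Γ_k} Q^{(j)}_{k-1,k}(z_{k-1};dz_k)…Q^{(j)}_{1,2}(z₁;dz₂) μ^{(j)}(dz₁); that is, the conditional distribution of (Z₁,…,Z_k) given X=j is the distribution of a Markov chain. -/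

import Mathlib

open MeasureTheory ProbabilityTheory
open scoped ENNReal

/-- `chainTail Q Γ m i z` is the iterated integral
`∫_{Γ_i} … ∫_{Γ_{i+m-1}} Q_{i+m-1}(z_{i+m-2}; dz_{i+m-1}) … Q_i(z; dz_i)`,
i.e. the probability that the next `m` steps of a Markov chain with transition kernels `Q`,
currently at state `z` (at time `i-1`), land successively in `Γ_i, …, Γ_{i+m-1}`. -/
noncomputable def chainTail (Q : ℕ → Kernel ℝ ℝ) (Γ : ℕ → Set ℝ) : ℕ → ℕ → ℝ → ℝ≥0∞
  | 0, _, _ => 1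
  | m + 1, i, z => ∫⁻ y in Γ i, chainTail Q Γ m (i+1) y ∂(Q i z)

/-- The σ-field generated by `Z_1, …, Z_k`. -/
def sigmaZ {Ω : Type*} (k : ℕ) (Z : ℕ → Ω → ℝ) : MeasurableSpace Ω :=
  ⨆ (i : ℕ) (_ : 1 ≤ i ∧ i ≤ k), MeasurableSpace.comap (Z i) inferInstance

/-- The expectation of the product of the weights `f l z_{l-1} z_l` over the next `m` steps of a
Markov chain with transition kernels `Q`, started at state `z` at time `i - 1`. -/
noncomputable def weightedTail (Q : ℕ → Kernel ℝ ℝ) (f : ℕ → ℝ → ℝ → ℝ≥0∞) : ℕ → ℕ → ℝ → ℝ≥0∞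
  | 0, _, _ => 1
  | m + 1, i, z => ∫⁻ y, f i z y * weightedTail Q f m (i + 1) y ∂(Q i z)

/-- The product of the weights `f l (p (l-1)) (p l)` for `l = i, …, i + m - 1` along a path `p`,
where the state at time `i - 1` is replaced by `z`. -/
noncomputable def pathWeight (f : ℕ → ℝ → ℝ → ℝ≥0∞) : ℕ → ℕ → ℝ → (ℕ → ℝ) → ℝ≥0∞
  | 0, _, _, _ => 1
  | m + 1, i, z, p => f i z (p i) * pathWeight f m (i + 1) (p i) p

/-- The law of the path of the next `m` steps of a Markov chain with transition kernels `Q`,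
started at time `i - 1`; the other coordinates of the path are zero. -/
noncomputable def pathKernel (Q : ℕ → Kernel ℝ ℝ) : ℕ → ℕ → Kernel ℝ (ℕ → ℝ)
  | 0, _ => Kernel.const ℝ (Measure.dirac 0)
  | m + 1, i => ((Q i) ⊗ₖ ((pathKernel Q m (i + 1)).comap Prod.snd measurable_snd)).map
      (fun q : ℝ × (ℕ → ℝ) => Function.update q.2 i q.1)

theorem measurable_update_path (i : ℕ) :
    Measurable (fun q : ℝ × (ℕ → ℝ) => Function.update q.2 i q.1) := by
  refine measurable_pi_iff.2 fun l => ?_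
  by_cases h : l = i
  · subst h; simpa using measurable_fst
  · simp only [Function.update_of_ne h]; fun_prop

instance isMarkovKernel_pathKernel (Q : ℕ → Kernel ℝ ℝ) [∀ i, IsMarkovKernel (Q i)] (m i : ℕ) :
    IsMarkovKernel (pathKernel Q m i) := by
  induction m generalizing i with
  | zero => unfold pathKernel; infer_instance
  | succ m ih =>
    have := ih (i + 1)
    unfold pathKernel
    exact Kernel.IsMarkovKernel.map _ (measurable_update_path i)

theorem lintegral_pathKernel_succ (Q : ℕ → Kernel ℝ ℝ) [∀ i, IsMarkovKernel (Q i)] (m i : ℕ)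
    (z : ℝ) {F : (ℕ → ℝ) → ℝ≥0∞} (hF : Measurable F) :
    ∫⁻ p, F p ∂(pathKernel Q (m + 1) i z)
      = ∫⁻ y, ∫⁻ p, F (Function.update p i y) ∂(pathKernel Q m (i + 1) y) ∂(Q i z) := by
  rw [pathKernel, Kernel.lintegral_map _ (measurable_update_path i) _ hF]
  exact Kernel.lintegral_compProd _ _ _ (hF.comp (measurable_update_path i))

theorem measurable_weightedTail (Q : ℕ → Kernel ℝ ℝ) [∀ i, IsMarkovKernel (Q i)]
    {f : ℕ → ℝ → ℝ → ℝ≥0∞} (hf : ∀ l, Measurable (Function.uncurry (f l))) (m i : ℕ) :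
    Measurable (weightedTail Q f m i) := by
  induction m generalizing i with
  | zero => exact measurable_const
  | succ m ih =>
    exact Measurable.lintegral_kernel_prod_right' (κ := Q i)
      (f := fun q : ℝ × ℝ => f i q.1 q.2 * weightedTail Q f m (i + 1) q.2)
      ((hf i).mul ((ih (i + 1)).comp measurable_snd))

theorem measurable_pathWeight {f : ℕ → ℝ → ℝ → ℝ≥0∞}
    (hf : ∀ l, Measurable (Function.uncurry (f l))) (m i : ℕ) :
    Measurable (fun q : ℝ × (ℕ → ℝ) => pathWeight f m i q.1 q.2) := by
  induction m generalizing i with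
  | zero => exact measurable_const
  | succ m ih =>
    have h1 : Measurable (fun q : ℝ × (ℕ → ℝ) => (q.1, q.2 i)) := by fun_prop
    have h2 : Measurable (fun q : ℝ × (ℕ → ℝ) => (q.2 i, q.2)) := by fun_prop
    exact ((hf i).comp h1).mul ((ih (i + 1)).comp h2)

theorem measurable_pathWeight_right {f : ℕ → ℝ → ℝ → ℝ≥0∞}
    (hf : ∀ l, Measurable (Function.uncurry (f l))) (m i : ℕ) (z : ℝ) :
    Measurable (pathWeight f m i z) :=
  (measurable_pathWeight hf m i).comp measurable_prodMk_left

theorem pathWeight_congr (f : ℕ → ℝ → ℝ → ℝ≥0∞) {m i : ℕ} (z : ℝ) {p q : ℕ → ℝ}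
    (h : ∀ l, i ≤ l → l < i + m → p l = q l) : pathWeight f m i z p = pathWeight f m i z q := by
  induction m generalizing i z with
  | zero => rfl
  | succ m ih =>
    rw [pathWeight, pathWeight, h i le_rfl (by omega),
      ih _ fun l h1 h2 => h l (by omega) (by omega)]

theorem pathWeight_eq_prod (f : ℕ → ℝ → ℝ → ℝ≥0∞) (m i : ℕ) (p : ℕ → ℝ) :
    pathWeight f m (i + 1) (p i) p
      = ∏ l ∈ Finset.Ico (i + 1) (i + 1 + m), f l (p (l - 1)) (p l) := by
  induction m generalizing i with
  | zero => simp [pathWeight]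
  | succ m ih =>
    rw [pathWeight, ih, Finset.prod_eq_prod_Ico_succ_bot (a := i + 1) (by omega),
      Nat.add_sub_cancel, show i + 1 + (m + 1) = i + 1 + 1 + m by omega]

theorem lintegral_pathWeight (Q : ℕ → Kernel ℝ ℝ) [∀ i, IsMarkovKernel (Q i)]
    {f : ℕ → ℝ → ℝ → ℝ≥0∞} (hf : ∀ l, Measurable (Function.uncurry (f l))) (m i : ℕ) (z : ℝ) :
    ∫⁻ p, pathWeight f m i z p ∂(pathKernel Q m i z) = weightedTail Q f m i z := by
  induction m generalizing i z with
  | zero => simp [pathWeight, weightedTail]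
  | succ m ih =>
    rw [lintegral_pathKernel_succ Q m i z (measurable_pathWeight_right hf _ _ _), weightedTail]
    refine lintegral_congr fun y => ?_
    rw [← ih, ← lintegral_const_mul _ (measurable_pathWeight_right hf _ _ _)]
    refine lintegral_congr fun p => ?_
    rw [pathWeight, Function.update_self, pathWeight_congr f y fun l h1 _ =>
      Function.update_of_ne (by omega) _ _]

theorem measurable_indicator_weight {Γ : ℕ → Set ℝ} (hΓ : ∀ i, MeasurableSet (Γ i)) (l : ℕ) :
    Measurable (Function.uncurry fun _ y : ℝ => (Γ l).indicator (1 : ℝ → ℝ≥0∞) y) :=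
  (measurable_one.indicator (hΓ l)).comp measurable_snd

theorem chainTail_eq_weightedTail (Q : ℕ → Kernel ℝ ℝ) {Γ : ℕ → Set ℝ}
    (hΓ : ∀ i, MeasurableSet (Γ i)) (m i : ℕ) (z : ℝ) :
    chainTail Q Γ m i z
      = weightedTail Q (fun l _ y => (Γ l).indicator (1 : ℝ → ℝ≥0∞) y) m i z := by
  induction m generalizing i z with
  | zero => rfl
  | succ m ih =>
    rw [chainTail, weightedTail, ← lintegral_indicator (hΓ i)]
    refine lintegral_congr fun y => ?_
    by_cases h : y ∈ Γ i <;> simp [h, ih]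

theorem chainTail_congr {Q Q' : ℕ → Kernel ℝ ℝ} (Γ : ℕ → Set ℝ) {m i : ℕ}
    (h : ∀ l, i ≤ l → Q l = Q' l) (z : ℝ) : chainTail Q Γ m i z = chainTail Q' Γ m i z := by
  induction m generalizing i z with
  | zero => rfl
  | succ m ih =>
    rw [chainTail, chainTail, h i le_rfl]
    exact lintegral_congr fun y => ih (fun l hl => h l (by omega)) y

theorem prod_indicator_one (s : Finset ℕ) (Γ : ℕ → Set ℝ) (p : ℕ → ℝ) :
    ∏ l ∈ s, (Γ l).indicator (1 : ℝ → ℝ≥0∞) (p l)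
      = {q : ℕ → ℝ | ∀ l ∈ s, q l ∈ Γ l}.indicator 1 p := by
  by_cases h : ∀ l ∈ s, p l ∈ Γ l
  · rw [Set.indicator_of_mem (by exact h)]
    exact Finset.prod_eq_one fun l hl => by simp [h l hl]
  · rw [Set.indicator_of_notMem (by exact h)]
    push Not at h
    obtain ⟨l, hl, hp⟩ := h
    exact Finset.prod_eq_zero hl (by simp [hp])

theorem measurableSet_forall_mem (s : Finset ℕ) {Γ : ℕ → Set ℝ} (hΓ : ∀ i, MeasurableSet (Γ i)) :
    MeasurableSet {q : ℕ → ℝ | ∀ l ∈ s, q l ∈ Γ l} := by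
  have : {q : ℕ → ℝ | ∀ l ∈ s, q l ∈ Γ l} = ⋂ l ∈ s, (fun q : ℕ → ℝ => q l) ⁻¹' Γ l := by
    ext; simp
  rw [this]
  exact Finset.measurableSet_biInter s fun l _ => measurable_pi_apply l (hΓ l)

theorem pathKernel_forall_mem (Q : ℕ → Kernel ℝ ℝ) [∀ i, IsMarkovKernel (Q i)] {Γ : ℕ → Set ℝ}
    (hΓ : ∀ i, MeasurableSet (Γ i)) (m i : ℕ) (z : ℝ) :
    pathKernel Q m (i + 1) z {p | ∀ l ∈ Finset.Ico (i + 1) (i + 1 + m), p l ∈ Γ l}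
      = chainTail Q Γ m (i + 1) z := by
  rw [chainTail_eq_weightedTail Q hΓ, ← lintegral_pathWeight Q (measurable_indicator_weight hΓ),
    ← lintegral_indicator_one (measurableSet_forall_mem _ hΓ)]
  refine lintegral_congr fun p => ?_
  rw [← prod_indicator_one, pathWeight_congr _ z (q := Function.update p i z) fun l h _ =>
    (Function.update_of_ne (by omega) _ _).symm]
  have := pathWeight_eq_prod (fun l _ y => (Γ l).indicator (1 : ℝ → ℝ≥0∞) y) m i
    (Function.update p i z)
  rw [Function.update_self] at this
  rw [this]
  refine Finset.prod_congr rfl fun l hl => ?_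
  rw [Function.update_of_ne (by simp at hl; omega)]

/-- Finite measures on paths that agree on rectangles in the coordinates `s` give the same
integral to every function of those coordinates. -/
theorem lintegral_eq_of_forall_mem {μ ν : Measure (ℕ → ℝ)} [IsFiniteMeasure μ] (s : Finset ℕ)
    (h : ∀ Γ : ℕ → Set ℝ, (∀ i, MeasurableSet (Γ i)) →
      μ {p | ∀ l ∈ s, p l ∈ Γ l} = ν {p | ∀ l ∈ s, p l ∈ Γ l})
    {F : (ℕ → ℝ) → ℝ≥0∞} (hF : Measurable F)
    (hFs : ∀ p q : ℕ → ℝ, (∀ l ∈ s, p l = q l) → F p = F q) :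
    ∫⁻ p, F p ∂μ = ∫⁻ p, F p ∂ν := by
  let R : (ℕ → ℝ) → ℕ → ℝ := fun p l => if l ∈ s then p l else 0
  have hR : Measurable R := by
    refine measurable_pi_iff.2 fun l => ?_
    by_cases hl : l ∈ s
    · simpa [R, hl] using measurable_pi_apply l
    · simp [R, hl]
  have hFR : ∀ p, F p = F (R p) := fun p => hFs _ _ fun l hl => by simp [R, hl]
  have key : μ.map R = ν.map R := by
    refine ext_of_generate_finite _ generateFrom_squareCylinders.symm
      (isPiSystem_squareCylinders (fun _ => MeasurableSpace.isPiSystem_measurableSet) (by simp)) ?_ ?_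
    · rintro _ ⟨t, B, hB, rfl⟩
      obtain ⟨A, hA', hBA⟩ : ∃ A : ℕ → Set ℝ, (∀ l, MeasurableSet (A l)) ∧
          (t : Set ℕ).pi B = Set.pi Set.univ A := by
        refine ⟨fun l => if l ∈ t then B l else Set.univ, fun l => ?_, ?_⟩
        · dsimp only; split_ifs
          exacts [hB l trivial, .univ]
        · ext p
          simp only [Set.mem_pi, Finset.mem_coe, Set.mem_univ, true_imp_iff]
          refine forall_congr' fun l => ?_
          split_ifs with hl <;> simp [hl]
      rw [hBA]
      have hm : MeasurableSet (Set.pi Set.univ A) := MeasurableSet.univ_pi hA'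
      rw [Measure.map_apply hR hm, Measure.map_apply hR hm]
      by_cases h0 : ∀ l ∉ s, (0 : ℝ) ∈ A l
      · have : R ⁻¹' Set.pi Set.univ A = {p | ∀ l ∈ s, p l ∈ A l} := by
          ext p
          simp only [Set.mem_preimage, Set.mem_pi, Set.mem_univ, true_imp_iff, Set.mem_ofPred_eq]
          refine ⟨fun hp l hl => by simpa [R, hl] using hp l, fun hp l => ?_⟩
          by_cases hl : l ∈ s
          · simpa [R, hl] using hp l hl
          · simpa [R, hl] using h0 l hl
        rw [this, h A hA']
      · have : R ⁻¹' Set.pi Set.univ A = ∅ := by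
          push Not at h0
          obtain ⟨l, hl, hn⟩ := h0
          refine Set.eq_empty_of_forall_notMem fun p hp => hn ?_
          simpa [R, hl] using hp l trivial
        rw [this, measure_empty, measure_empty]
    · rw [Measure.map_apply hR .univ, Measure.map_apply hR .univ]
      simpa using h (fun _ => Set.univ) fun _ => .univ
  calc ∫⁻ p, F p ∂μ = ∫⁻ p, F p ∂μ.map R := by
        rw [lintegral_map hF hR]; exact lintegral_congr hFR
    _ = ∫⁻ p, F p ∂ν := by
        rw [key, lintegral_map hF hR]; exact (lintegral_congr hFR).symm

/-- Reweighting a Markov kernel by a bounded density and normalizing gives a Markov kernel. -/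
theorem exists_isMarkovKernel_lintegral_mul (κ : Kernel ℝ ℝ) [IsMarkovKernel κ]
    {φ : ℝ → ℝ → ℝ≥0∞} (hφ : Measurable (Function.uncurry φ)) (hφ1 : ∀ z y, φ z y ≤ 1) :
    ∃ η : Kernel ℝ ℝ, IsMarkovKernel η ∧ ∀ (z : ℝ) (F : ℝ → ℝ≥0∞), Measurable F →
      ∫⁻ y, φ z y * F y ∂(κ z) = (∫⁻ y, φ z y ∂(κ z)) * ∫⁻ y, F y ∂(η z) := by
  classical
  let H : ℝ → ℝ≥0∞ := fun z => ∫⁻ y, φ z y ∂(κ z)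
  have hH : Measurable H := hφ.lintegral_kernel_prod_right'
  have hHtop : ∀ z, H z ≠ ∞ := fun z =>
    ((lintegral_mono (hφ1 z)).trans_lt (by simp)).ne
  have hd : Measurable (Function.uncurry fun z y => (H z)⁻¹ * φ z y) :=
    (hH.inv.comp measurable_fst).mul hφ
  have hs : MeasurableSet {z | H z = 0} := hH (measurableSet_singleton 0)
  have hφz : ∀ z, Measurable (φ z) := fun z => hφ.comp measurable_prodMk_left
  have hφF : ∀ z, ∀ F : ℝ → ℝ≥0∞, Measurable F → Measurable fun y => φ z y * F y :=
    fun z F hF => (hφz z).mul hF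
  let η := Kernel.piecewise hs κ (Kernel.withDensity κ fun z y => (H z)⁻¹ * φ z y)
  have hη : ∀ z, H z ≠ 0 → ∀ F : ℝ → ℝ≥0∞, Measurable F →
      ∫⁻ y, F y ∂(η z) = (H z)⁻¹ * ∫⁻ y, φ z y * F y ∂(κ z) := fun z hz F hF => by
    simp only [η, Kernel.lintegral_piecewise, Set.mem_ofPred_eq, hz, if_false]
    rw [Kernel.lintegral_withDensity _ hd z hF, ← lintegral_const_mul _ (hφF z F hF)]
    simp only [mul_assoc]
  refine ⟨η, ⟨fun z => ⟨?_⟩⟩, fun z F hF => ?_⟩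
  · by_cases hz : H z = 0
    · simp [η, Kernel.piecewise_apply, hz]
    · have := hη z hz 1 measurable_one
      simp only [Pi.one_apply, lintegral_one, mul_one] at this
      rw [this]
      exact ENNReal.inv_mul_cancel hz (hHtop z)
  · change _ = H z * _
    by_cases hz : H z = 0
    · rw [hz, zero_mul, lintegral_eq_zero_iff (hφF z F hF)]
      filter_upwards [(lintegral_eq_zero_iff (hφz z)).1 hz] with y hy
      simp [hy]
    · rw [hη z hz F hF, ← mul_assoc, ENNReal.mul_inv_cancel hz (hHtop z), one_mul]

theorem weightedTail_le_one (Q : ℕ → Kernel ℝ ℝ) [∀ i, IsMarkovKernel (Q i)]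
    {f : ℕ → ℝ → ℝ → ℝ≥0∞} (hf1 : ∀ l z y, f l z y ≤ 1) (m i : ℕ) (z : ℝ) :
    weightedTail Q f m i z ≤ 1 := by
  induction m generalizing i z with
  | zero => exact le_rfl
  | succ m ih =>
    refine (lintegral_mono fun y => mul_le_one' (hf1 i z y) (ih (i + 1) y)).trans ?_
    simp

/-- The Doob transform: a Markov chain of length `k` reweighted by a product of bounded weights
of its steps is, up to normalization, again a Markov chain. -/
theorem exists_weightedTail_eq_mul_chainTail (Q : ℕ → Kernel ℝ ℝ) [∀ i, IsMarkovKernel (Q i)]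
    {w : ℕ → ℝ → ℝ → ℝ≥0∞} (hw : ∀ l, Measurable (Function.uncurry (w l)))
    (hw1 : ∀ l z y, w l z y ≤ 1) (k : ℕ) :
    ∃ Q' : ℕ → Kernel ℝ ℝ, (∀ i, IsMarkovKernel (Q' i)) ∧
      ∀ Γ : ℕ → Set ℝ, (∀ i, MeasurableSet (Γ i)) → ∀ m i, i + m = k + 1 → ∀ z,
        weightedTail Q (fun l z y => (Γ l).indicator 1 y * w l z y) m i z
          = weightedTail Q w m i z * chainTail Q' Γ m i z := by
  have hφ : ∀ i, Measurable (Function.uncurry fun z y =>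
      w i z y * weightedTail Q w (k - i) (i + 1) y) := fun i =>
    (hw i).mul ((measurable_weightedTail Q hw _ _).comp measurable_snd)
  choose Q' hQ' hint using fun i => exists_isMarkovKernel_lintegral_mul (Q i) (hφ i)
    fun z y => mul_le_one' (hw1 i z y) (weightedTail_le_one Q hw1 _ _ y)
  refine ⟨Q', hQ', fun Γ hΓ m => ?_⟩
  induction m with
  | zero => intro i _ z; simp [weightedTail, chainTail]
  | succ m ih =>
    intro i hi z
    have hchain : Measurable (chainTail Q' Γ m (i + 1)) := by
      rw [funext (chainTail_eq_weightedTail Q' hΓ m (i + 1))]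
      exact measurable_weightedTail Q' (measurable_indicator_weight hΓ) _ _
    have := hint i z ((Γ i).indicator (chainTail Q' Γ m (i + 1))) (hchain.indicator (hΓ i))
    rw [show k - i = m by omega, lintegral_indicator (hΓ i)] at this
    rw [weightedTail, weightedTail, chainTail, ← this]
    refine lintegral_congr fun y => ?_
    rw [ih (i + 1) (by omega) y]
    by_cases hy : y ∈ Γ i <;> simp [hy, mul_assoc]

theorem chainTail_univ (Q : ℕ → Kernel ℝ ℝ) [∀ i, IsMarkovKernel (Q i)] (m i : ℕ) (z : ℝ) :
    chainTail Q (fun _ => Set.univ) m i z = 1 := by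
  induction m generalizing i z with
  | zero => rfl
  | succ m ih => simp [chainTail, ih]

theorem sigmaZ_le {Ω : Type*} [m : MeasurableSpace Ω] (k : ℕ) {Z : ℕ → Ω → ℝ}
    (hZ : ∀ i, Measurable (Z i)) : sigmaZ k Z ≤ m :=
  iSup₂_le fun i _ => (hZ i).comap_le

theorem measurableSet_sigmaZ {Ω : Type*} (k : ℕ) (Z : ℕ → Ω → ℝ) {Γ : ℕ → Set ℝ}
    (hΓ : ∀ i, MeasurableSet (Γ i)) :
    MeasurableSet[sigmaZ k Z] {ω | ∀ i, 1 ≤ i → i ≤ k → Z i ω ∈ Γ i} := by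
  have : {ω | ∀ i, 1 ≤ i → i ≤ k → Z i ω ∈ Γ i}
      = ⋂ i ∈ {i : ℕ | 1 ≤ i ∧ i ≤ k}, Z i ⁻¹' Γ i := by
    ext; simp
  rw [this]
  refine MeasurableSet.biInter (Set.to_countable _) fun i hi => ?_
  exact le_iSup₂ (f := fun (i : ℕ) (_ : 1 ≤ i ∧ i ≤ k) =>
    MeasurableSpace.comap (Z i) inferInstance) i hi _ ⟨Γ i, hΓ i, rfl⟩

theorem measure_inter_eq_setLIntegral_of_condExp {Ω : Type*} {m m0 : MeasurableSpace Ω}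
    {P : Measure Ω} [IsFiniteMeasure P] (hm : m ≤ m0) {A E : Set Ω} (hA : MeasurableSet A)
    (hE : MeasurableSet[m] E) {Y : Ω → ℝ} (hY0 : 0 ≤ᵐ[P] Y)
    (hY : P[A.indicator (fun _ => (1 : ℝ)) | m] =ᵐ[P] Y) :
    P (A ∩ E) = ∫⁻ ω in E, ENNReal.ofReal (Y ω) ∂P := by
  have hint : Integrable (A.indicator fun _ => (1 : ℝ)) P := (integrable_const 1).indicator hA
  have hYint : Integrable Y P := integrable_condExp.congr hY
  rw [← ofReal_integral_eq_lintegral_ofReal hYint.restrict (ae_restrict_of_ae hY0),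
    ← integral_congr_ae (ae_restrict_of_ae hY), setIntegral_condExp hm hint hE,
    integral_indicator_const _ hA, measureReal_restrict_apply hA]
  simp [measureReal_def]

/-- The weights whose product along a path `p` in `[0,1]` started at `0` is the `j`-th
increment of `p`, where `p (k + 1) = 1`. -/
noncomputable def incrementWeight (k j l : ℕ) (z y : ℝ) : ℝ≥0∞ :=
  if l = j then min 1 (ENNReal.ofReal (y - z))
  else if l = k ∧ j = k + 1 then min 1 (ENNReal.ofReal (1 - y)) else 1

theorem measurable_incrementWeight (k j l : ℕ) :
    Measurable (Function.uncurry (incrementWeight k j l)) := by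
  unfold incrementWeight Function.uncurry
  split_ifs <;> fun_prop

theorem incrementWeight_le_one (k j l : ℕ) (z y : ℝ) : incrementWeight k j l z y ≤ 1 := by
  unfold incrementWeight
  split_ifs <;> simp

theorem prod_incrementWeight {k j : ℕ} (hk : 1 ≤ k) (hj : 1 ≤ j) (hjk : j ≤ k + 1) {p : ℕ → ℝ}
    (htop : p (k + 1) = 1) (hp : p j - p (j - 1) ≤ 1) :
    ∏ l ∈ Finset.Ico 1 (k + 1), incrementWeight k j l (p (l - 1)) (p l)
      = ENNReal.ofReal (p j - p (j - 1)) := by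
  have hle : ENNReal.ofReal (p j - p (j - 1)) ≤ 1 := by simpa using hp
  rcases Nat.lt_or_ge k j with h | h
  · obtain rfl : j = k + 1 := by omega
    rw [Finset.prod_eq_single_of_mem k (by simp; omega)]
    · rw [htop, Nat.add_sub_cancel] at *
      simp [incrementWeight, hle]
    · intro l hl hlk
      simp only [Finset.mem_Ico] at hl
      simp [incrementWeight, hlk, show l ≠ k + 1 by omega]
  · rw [Finset.prod_eq_single_of_mem j (by simp; omega)]
    · simp [incrementWeight, hle]
    · intro l hl hlj
      simp [incrementWeight, hlj, show j ≠ k + 1 by omega]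

/-- Lemma B.1. Let `(Z₁,…,Z_k)` be an increasing Markov chain with values in
`[0,1]`, `Z₀ := 0`, `Z_{k+1} := 1`, `Y_j := Z_j - Z_{j-1}`, and let `X` be a random variable
with `𝒫[X = j | Z₁,…,Z_k] = Y_j` for `j = 1,…,k+1`. Then for each such `j`, the conditional
distribution of `(Z₁,…,Z_k)` given `X = j` is the distribution of a Markov chain with some
initial distribution `μ⁽ʲ⁾` and transition kernels `Q⁽ʲ⁾`. -/
theorem stmt18 {Ω : Type*} [MeasurableSpace Ω] (Pr : Measure Ω) [IsProbabilityMeasure Pr]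
    (k : ℕ) (hk : 1 ≤ k) (Z : ℕ → Ω → ℝ) (hZmeas : ∀ i, Measurable (Z i))
    (hZ0 : ∀ ω, Z 0 ω = 0) (hZtop : ∀ ω, Z (k+1) ω = 1)
    (hmono : ∀ᵐ ω ∂Pr, ∀ i ≤ k, Z i ω ≤ Z (i+1) ω)
    (μ0 : Measure ℝ) [IsProbabilityMeasure μ0]
    (Q : ℕ → Kernel ℝ ℝ) [∀ i, IsMarkovKernel (Q i)]
    -- `(Z₁,…,Z_k)` is a Markov chain with initial distribution `μ0` and kernels `Q`
    (hchain : ∀ Γ : ℕ → Set ℝ, (∀ i, MeasurableSet (Γ i)) →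
      Pr {ω | ∀ i, 1 ≤ i → i ≤ k → Z i ω ∈ Γ i}
        = ∫⁻ z in Γ 1, chainTail Q Γ (k-1) 2 z ∂μ0)
    (X : Ω → ℕ) (hX : Measurable X) (hXrange : ∀ ω, 1 ≤ X ω ∧ X ω ≤ k+1)
    (hXcond : ∀ j, 1 ≤ j → j ≤ k+1 →
      Pr[Set.indicator {ω | X ω = j} (fun _ => (1:ℝ)) | sigmaZ k Z]
        =ᵐ[Pr] fun ω => Z j ω - Z (j-1) ω) :
    ∀ j, 1 ≤ j → j ≤ k+1 → 0 < Pr {ω | X ω = j} →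
      ∃ (μj : Measure ℝ) (Qj : ℕ → Kernel ℝ ℝ),
        IsProbabilityMeasure μj ∧ (∀ i, IsMarkovKernel (Qj i)) ∧
        ∀ Γ : ℕ → Set ℝ, (∀ i, MeasurableSet (Γ i)) →
          Pr[|{ω | X ω = j}] {ω | ∀ i, 1 ≤ i → i ≤ k → Z i ω ∈ Γ i}
            = ∫⁻ z in Γ 1, chainTail Qj Γ (k-1) 2 z ∂μj := by
  intro j hj1 hjk hpos
  let Q₁ : ℕ → Kernel ℝ ℝ := fun i => if i = 1 then Kernel.const ℝ μ0 else Q i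
  have hQ₁ : ∀ i, IsMarkovKernel (Q₁ i) := fun i => by
    simp only [Q₁]; split_ifs <;> infer_instance
  have hZpath : Measurable fun ω l => Z l ω := measurable_pi_iff.2 hZmeas
  have hIco : ∀ (Γ : ℕ → Set ℝ) (p : ℕ → ℝ), (∀ i, 1 ≤ i → i ≤ k → p i ∈ Γ i) ↔
      ∀ l ∈ Finset.Ico (0 + 1) (0 + 1 + k), p l ∈ Γ l := fun Γ p => by
    simp only [Finset.mem_Ico]
    exact ⟨fun h l hl => h l (by omega) (by omega), fun h l h1 h2 => h l (by omega)⟩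
  have hlaw : ∀ Γ : ℕ → Set ℝ, (∀ i, MeasurableSet (Γ i)) →
      (Pr.map fun ω l => Z l ω) {p | ∀ l ∈ Finset.Ico (0 + 1) (0 + 1 + k), p l ∈ Γ l}
        = pathKernel Q₁ k (0 + 1) 0 {p | ∀ l ∈ Finset.Ico (0 + 1) (0 + 1 + k), p l ∈ Γ l} := by
    intro Γ hΓ
    rw [pathKernel_forall_mem Q₁ hΓ, Measure.map_apply hZpath (measurableSet_forall_mem _ hΓ)]
    have := hchain Γ hΓ
    simp only [hIco Γ fun l => Z l _] at this
    refine this.trans ?_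
    obtain ⟨n, rfl⟩ : ∃ n, k = n + 1 := ⟨k - 1, by omega⟩
    rw [chainTail, Nat.add_sub_cancel]
    simp only [Q₁, zero_add, if_true, Kernel.const_apply]
    exact lintegral_congr fun y => chainTail_congr Γ (fun l hl => by simp; omega) y
  have hbound : ∀ᵐ ω ∂Pr, 0 ≤ Z j ω - Z (j - 1) ω ∧ Z j ω - Z (j - 1) ω ≤ 1 := by
    filter_upwards [hmono] with ω h
    have hmon : ∀ a b, a ≤ b → b ≤ k + 1 → Z a ω ≤ Z b ω := by
      intro a b hab
      induction b, hab using Nat.le_induction with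
      | base => exact fun _ => le_rfl
      | succ b _ ih => exact fun hb => (ih (by omega)).trans (h b (by omega))
    have h1 := hmon (j - 1) j (by omega) hjk
    have h2 := hmon 0 (j - 1) (by omega) (by omega)
    have h3 := hmon j (k + 1) hjk le_rfl
    rw [hZ0] at h2
    rw [hZtop] at h3
    constructor <;> linarith
  have hA : MeasurableSet {ω | X ω = j} := hX (measurableSet_singleton j)
  obtain ⟨Q', hQ', hdoob⟩ := exists_weightedTail_eq_mul_chainTail Q₁
    (measurable_incrementWeight k j) (incrementWeight_le_one k j) k
  have hjoint : ∀ Γ : ℕ → Set ℝ, (∀ i, MeasurableSet (Γ i)) →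
      Pr ({ω | X ω = j} ∩ {ω | ∀ i, 1 ≤ i → i ≤ k → Z i ω ∈ Γ i})
        = weightedTail Q₁ (incrementWeight k j) k 1 0 * chainTail Q' Γ k 1 0 := by
    intro Γ hΓ
    have hE := measurableSet_sigmaZ k Z hΓ
    have hf : ∀ l, Measurable (Function.uncurry fun z y : ℝ =>
        (Γ l).indicator (1 : ℝ → ℝ≥0∞) y * incrementWeight k j l z y) := fun l =>
      (measurable_indicator_weight hΓ l).mul (measurable_incrementWeight k j l)
    have hG := measurable_pathWeight_right hf k (0 + 1) 0
    rw [← hdoob Γ hΓ k 1 (by omega) 0, ← lintegral_pathWeight Q₁ hf,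
      measure_inter_eq_setLIntegral_of_condExp (sigmaZ_le k hZmeas) hA hE
        (hbound.mono fun ω h => h.1) (hXcond j hj1 hjk),
      ← lintegral_indicator (sigmaZ_le k hZmeas _ hE)]
    refine Eq.trans ?_ (lintegral_eq_of_forall_mem _ hlaw hG fun p q h =>
      pathWeight_congr _ _ fun l h1 h2 => h l (by simp; omega))
    rw [lintegral_map hG hZpath]
    refine lintegral_congr_ae ?_
    filter_upwards [hbound] with ω h
    have hprod := pathWeight_eq_prod
      (fun l z y => (Γ l).indicator (1 : ℝ → ℝ≥0∞) y * incrementWeight k j l z y) k 0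
      (fun l => Z l ω)
    rw [hZ0] at hprod
    rw [hprod, Finset.prod_mul_distrib, prod_indicator_one _ Γ (fun l => Z l ω),
      show 0 + 1 + k = k + 1 by omega,
      prod_incrementWeight hk hj1 hjk (p := fun l => Z l ω) (hZtop ω) h.2]
    by_cases hω : ∀ i, 1 ≤ i → i ≤ k → Z i ω ∈ Γ i
    · rw [Set.indicator_of_mem (by exact hω), Set.indicator_of_mem (by simpa using hω)]
      simp
    · rw [Set.indicator_of_notMem (by exact hω), Set.indicator_of_notMem (by simpa using hω)]
      simp
  have hmass : Pr {ω | X ω = j} = weightedTail Q₁ (incrementWeight k j) k 1 0 := by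
    have h := hjoint (fun _ => Set.univ) fun _ => .univ
    rw [chainTail_univ] at h
    simpa using h
  refine ⟨Q' 1 0, Q', (hQ' 1).isProbabilityMeasure 0, hQ', fun Γ hΓ => ?_⟩
  rw [cond_apply hA, hjoint Γ hΓ, ← hmass, ← mul_assoc,
    ENNReal.inv_mul_cancel hpos.ne' (measure_ne_top _ _), one_mul]
  obtain ⟨n, rfl⟩ : ∃ n, k = n + 1 := ⟨k - 1, by omega⟩
  rfl
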